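/- Let T ≥ 1 and let (a,b) and (a',b') be two pairs of coefficient sequences such that a_k = a'_k for 0 ≤ k ≤ T-1 and b_k = b'_k for 1 ≤ k ≤ T. Let u^δ and u'^δ be the solutions of the corresponding discrete dynamical systems, both with control δ. Then u^δ(1,t) = u'^δ(1,t) for all 0 ≤ t ≤ 2T-1 (i.e., the response vector (r_0, r_1, ..., r_{2T-2}), with r_t = u^δ(1,t+1), depends only on a_0,...,a_{T-1} and b_1,...,b_T). -/

import Mathlib

/-- The control δ: δ(0)=1, δ(t)=0 for t ≥ 1. -/
noncomputable def deltaCtrl : ℕ → ℂ := fun t => if t = 0 then 1 else 0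

/-- `IsSol a b f u` : `u` is the solution of the semi-infinite discrete dynamical
system with coefficients `a`, `b` and boundary control `f`. -/
def IsSol (a b : ℕ → ℂ) (f : ℕ → ℂ) (u : ℕ → ℤ → ℂ) : Prop :=
  (∀ n : ℕ, 1 ≤ n → ∀ t : ℤ, t ≤ 0 → u n t = 0) ∧
  (∀ t : ℕ, u 0 (t : ℤ) = f t) ∧
  (∀ t : ℤ, t < 0 → u 0 t = 0) ∧
  (∀ n : ℕ, 1 ≤ n → ∀ t : ℕ,
    u n ((t : ℤ) + 1) + u n ((t : ℤ) - 1) - a n * u (n + 1) (t : ℤ)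
      - a (n - 1) * u (n - 1) (t : ℤ) - b n * u n (t : ℤ) = 0)

/-- Waves propagate with speed at most one. -/
theorem IsSol.eq_zero_of_lt {a b f : ℕ → ℂ} {u : ℕ → ℤ → ℂ} (hu : IsSol a b f u) (t : ℕ) :
    ∀ s : ℤ, s ≤ t → ∀ n : ℕ, 1 ≤ n → s < n → u n s = 0 := by
  obtain ⟨hinit, -, -, hrec⟩ := hu
  induction t with
  | zero => exact fun s hs n hn _ => hinit n hn s (by simpa using hs)
  | succ t ih =>
    intro s hs n hn hsn
    rcases hs.lt_or_eq with hlt | rfl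
    · exact ih s (by push_cast at hlt; omega) n hn hsn
    · push_cast at hsn ⊢
      have h := hrec n hn t
      rw [ih (t - 1) (by omega) n hn (by omega), ih t le_rfl (n + 1) (by omega) (by omega),
        ih t le_rfl (n - 1) (by omega) (by omega), ih t le_rfl n hn (by omega)] at h
      simpa using h

/-- Two systems with the same control whose coefficients agree up to depth `T` have the same
solution on the backward light cone `n + t ≤ 2 * T`. -/
theorem IsSol.eq_of_add_le {a b a' b' f : ℕ → ℂ} {u u' : ℕ → ℤ → ℂ} {T : ℕ}
    (hu : IsSol a b f u) (hu' : IsSol a' b' f u')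
    (haa : ∀ k < T, a k = a' k) (hbb : ∀ k, 1 ≤ k → k ≤ T → b k = b' k) (t : ℕ) :
    ∀ s : ℤ, s ≤ t → ∀ n : ℕ, n + s ≤ 2 * T → u n s = u' n s := by
  have boundary (s : ℤ) : u 0 s = u' 0 s := by
    rcases lt_or_ge s 0 with hs | hs
    · rw [hu.2.2.1 s hs, hu'.2.2.1 s hs]
    · lift s to ℕ using hs
      rw [hu.2.1, hu'.2.1]
  induction t with
  | zero =>
    intro s hs n _
    rcases Nat.eq_zero_or_pos n with rfl | hn
    · exact boundary s
    · rw [hu.1 n hn s (by simpa using hs), hu'.1 n hn s (by simpa using hs)]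
  | succ t ih =>
    intro s hs n hns
    rcases Nat.eq_zero_or_pos n with rfl | hn
    · exact boundary s
    rcases hs.lt_or_eq with hlt | rfl
    · exact ih s (by push_cast at hlt; omega) n hns
    rcases lt_or_ge (t + 1) n with hlt | hle
    · rw [hu.eq_zero_of_lt (t + 1) _ le_rfl n hn (by omega),
        hu'.eq_zero_of_lt (t + 1) _ le_rfl n hn (by omega)]
    push_cast at hns ⊢
    have hup : a n * u (n + 1) t = a' n * u' (n + 1) t := by
      rcases lt_or_ge n T with hnT | hnT
      · rw [haa n hnT, ih t le_rfl (n + 1) (by push_cast; omega)]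
      · rw [hu.eq_zero_of_lt t t le_rfl (n + 1) (by omega) (by push_cast; omega),
          hu'.eq_zero_of_lt t t le_rfl (n + 1) (by omega) (by push_cast; omega),
          mul_zero, mul_zero]
    have h := hu.2.2.2 n hn t
    rw [hup, haa (n - 1) (by omega), hbb n hn (by omega), ih t le_rfl (n - 1) (by omega),
      ih t le_rfl n (by omega), ih (t - 1) (by omega) n (by omega)] at h
    linear_combination h - hu'.2.2.2 n hn t

/-- The response vector up to time `2T - 1` depends only on the coefficients
`a 0, …, a (T-1)` and `b 1, …, b T`. -/
theorem response_depends_on_finitely_many_coefficients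
    (T : ℕ) (hT : 1 ≤ T)
    (a b a' b' : ℕ → ℂ)
    (haa : ∀ k : ℕ, k ≤ T - 1 → a k = a' k)
    (hbb : ∀ k : ℕ, 1 ≤ k → k ≤ T → b k = b' k)
    (u : ℕ → ℤ → ℂ) (hu : IsSol a b deltaCtrl u)
    (u' : ℕ → ℤ → ℂ) (hu' : IsSol a' b' deltaCtrl u') :
    ∀ t : ℕ, t ≤ 2 * T - 1 → u 1 (t : ℤ) = u' 1 (t : ℤ) := by
  intro t ht
  exact hu.eq_of_add_le hu' (fun k hk => haa k (by omega)) hbb t t le_rfl 1 (by omega)
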